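/- For every Δ > 0: ∫_0^∞ D(Δ, λ) dλ = π/2, where D(Δ, λ) = ∫_0^∞ (t/(2√(πλ³))) · e^{-t²/(4λ)} · ((1/t)·sin(√π·Δ·t) - Δ·√π·cos(√π·Δ·t)) dt. -/

import Mathlib

open Real MeasureTheory

/-- The density `D(Δ, λ)` of the measure `dμ_Δ(λ)` from the Gaussian subordination
representation of `arctan(Δ/x) - Δx/(x²+Δ²)`. -/
noncomputable def D (Δ l : ℝ) : ℝ :=
  ∫ t in Set.Ioi (0 : ℝ), (t / (2 * Real.sqrt (π * l ^ 3))) * Real.exp (-t ^ 2 / (4 * l)) *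
    ((1 / t) * Real.sin (Real.sqrt π * Δ * t) -
      Δ * Real.sqrt π * Real.cos (Real.sqrt π * Δ * t))

open Set Filter Topology

section GaussianSineTransform

variable {l : ℝ}

lemma integrable_exp_neg_sq_div (hl : 0 < l) :
    Integrable fun t : ℝ => exp (-t ^ 2 / (4 * l)) := by
  refine (integrable_exp_neg_mul_sq (b := 1 / (4 * l)) (by positivity)).congr
    (.of_forall fun t => ?_)
  dsimp only
  congr 1
  ring

lemma integrable_mul_exp_neg_sq_div (hl : 0 < l) :
    Integrable fun t : ℝ => t * exp (-t ^ 2 / (4 * l)) := by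
  refine (integrable_mul_exp_neg_mul_sq (b := 1 / (4 * l)) (by positivity)).congr
    (.of_forall fun t => ?_)
  dsimp only
  congr 2
  ring

lemma integrable_exp_neg_sq_div_mul_sin (hl : 0 < l) (x : ℝ) :
    Integrable fun t : ℝ => exp (-t ^ 2 / (4 * l)) * sin (x * t) :=
  (integrable_exp_neg_sq_div hl).mul_bdd (c := 1) (by fun_prop)
    (.of_forall fun t => by simpa using abs_sin_le_one _)

lemma integrable_mul_exp_neg_sq_div_mul_cos (hl : 0 < l) (x : ℝ) :
    Integrable fun t : ℝ => t * exp (-t ^ 2 / (4 * l)) * cos (x * t) :=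
  (integrable_mul_exp_neg_sq_div hl).mul_bdd (c := 1) (by fun_prop)
    (.of_forall fun t => by simpa using abs_cos_le_one _)

/-- Integration by parts for the Gaussian cosine moment. -/
lemma integral_mul_exp_neg_sq_div_mul_cos (hl : 0 < l) (x : ℝ) :
    ∫ t in Ioi (0 : ℝ), t * exp (-t ^ 2 / (4 * l)) * cos (x * t) =
      2 * l - 2 * l * x * ∫ t in Ioi (0 : ℝ), exp (-t ^ 2 / (4 * l)) * sin (x * t) := by
  have hderiv (t : ℝ) : HasDerivAt (fun t => -(2 * l) * (exp (-t ^ 2 / (4 * l)) * cos (x * t)))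
      (t * exp (-t ^ 2 / (4 * l)) * cos (x * t) +
        2 * l * x * (exp (-t ^ 2 / (4 * l)) * sin (x * t))) t := by
    have h1 : HasDerivAt (fun t : ℝ => -t ^ 2 / (4 * l)) (-(2 * t) / (4 * l)) t := by
      simpa using ((hasDerivAt_pow 2 t).neg.div_const (4 * l))
    have h2 : HasDerivAt (fun t : ℝ => x * t) x t := by
      simpa using (hasDerivAt_id t).const_mul x
    refine ((h1.exp.mul h2.cos).const_mul (-(2 * l))).congr_deriv ?_
    field_simp
    ring
  have hexp : Tendsto (fun t : ℝ => exp (-t ^ 2 / (4 * l))) atTop (𝓝 0) := by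
    refine tendsto_exp_atBot.comp ?_
    have : Tendsto (fun t : ℝ => t ^ 2 / (4 * l)) atTop atTop :=
      (tendsto_pow_atTop two_ne_zero).atTop_div_const (by positivity)
    simpa only [neg_div, Function.comp_def] using tendsto_neg_atTop_atBot.comp this
  have hlim : Tendsto (fun t => -(2 * l) * (exp (-t ^ 2 / (4 * l)) * cos (x * t))) atTop
      (𝓝 0) := by
    simpa using (hexp.zero_mul_isBoundedUnder_le (g := fun t => cos (x * t))
      (isBoundedUnder_of ⟨1, fun t => by simpa using abs_cos_le_one _⟩)).const_mul (-(2 * l))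
  have hc := (integrable_mul_exp_neg_sq_div_mul_cos hl x).integrableOn (s := Ioi 0)
  have hs := ((integrable_exp_neg_sq_div_mul_sin hl x).integrableOn (s := Ioi 0)).const_mul
    (2 * l * x)
  have h := integral_Ioi_of_hasDerivAt_of_tendsto' (a := 0) (fun t _ => hderiv t)
    (hc.add hs) hlim
  rw [integral_add hc hs, integral_const_mul] at h
  simp at h
  linarith

lemma hasDerivAt_integral_exp_neg_sq_div_mul_sin (hl : 0 < l) (x : ℝ) :
    HasDerivAt (fun x => ∫ t in Ioi (0 : ℝ), exp (-t ^ 2 / (4 * l)) * sin (x * t))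
      (2 * l - 2 * l * x * ∫ t in Ioi (0 : ℝ), exp (-t ^ 2 / (4 * l)) * sin (x * t)) x := by
  rw [← integral_mul_exp_neg_sq_div_mul_cos hl x]
  refine (hasDerivAt_integral_of_dominated_loc_of_deriv_le (s := univ)
    (bound := fun t => |t * exp (-t ^ 2 / (4 * l))|)
    (F' := fun x t => t * exp (-t ^ 2 / (4 * l)) * cos (x * t)) univ_mem
    (.of_forall fun y => (integrable_exp_neg_sq_div_mul_sin hl y).integrableOn.1)
    (integrable_exp_neg_sq_div_mul_sin hl x).integrableOn
    (integrable_mul_exp_neg_sq_div_mul_cos hl x).integrableOn.1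
    (.of_forall fun t y _ => ?_)
    (integrable_mul_exp_neg_sq_div hl).abs.integrableOn
    (.of_forall fun t y _ => ?_)).2
  · rw [norm_mul, Real.norm_eq_abs, Real.norm_eq_abs]
    exact mul_le_of_le_one_right (abs_nonneg _) (abs_cos_le_one _)
  · have h2 : HasDerivAt (fun y : ℝ => y * t) t y := by
      simpa using (hasDerivAt_id y).mul_const t
    exact (h2.sin.const_mul _).congr_deriv (by ring)

/-- A representation of the Gaussian sine transform as a Dawson integral. -/
lemma integral_exp_neg_sq_div_mul_sin (hl : 0 < l) (x : ℝ) :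
    ∫ t in Ioi (0 : ℝ), exp (-t ^ 2 / (4 * l)) * sin (x * t) =
      2 * l * x * ∫ θ in (0)..(π / 2), cos θ * exp (-(l * x ^ 2 * cos θ ^ 2)) := by
  set S : ℝ → ℝ := fun x => ∫ t in Ioi (0 : ℝ), exp (-t ^ 2 / (4 * l)) * sin (x * t) with hS
  have hderiv (θ : ℝ) : HasDerivAt
      (fun θ => S (x * sin θ) * exp (-(l * x ^ 2 * cos θ ^ 2)))
      (2 * l * x * (cos θ * exp (-(l * x ^ 2 * cos θ ^ 2)))) θ := by
    have h1 : HasDerivAt (fun θ => x * sin θ) (x * cos θ) θ := (hasDerivAt_sin θ).const_mul x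
    have h2 : HasDerivAt (fun θ => S (x * sin θ)) _ θ :=
      HasDerivAt.comp (h₂ := S) θ (hasDerivAt_integral_exp_neg_sq_div_mul_sin hl (x * sin θ)) h1
    have h3 := ((((hasDerivAt_cos θ).pow 2).const_mul (l * x ^ 2)).neg).exp
    refine (h2.mul h3).congr_deriv ?_
    simp only [hS, Pi.pow_apply, Pi.neg_apply]
    push_cast
    ring
  have h := intervalIntegral.integral_eq_sub_of_hasDerivAt (a := 0) (b := π / 2)
    (fun θ _ => hderiv θ) (Continuous.intervalIntegrable (by fun_prop) _ _)
  rw [intervalIntegral.integral_const_mul] at h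
  simp [hS] at h
  exact h.symm

end GaussianSineTransform

lemma integral_cos_mul_one_add_mul_exp (c : ℝ) :
    ∫ θ in (0)..(π / 2), cos θ * (1 + 2 * c * sin θ ^ 2) * exp (-(c * cos θ ^ 2)) = 1 := by
  have hderiv (θ : ℝ) : HasDerivAt (fun θ => sin θ * exp (-(c * cos θ ^ 2)))
      (cos θ * (1 + 2 * c * sin θ ^ 2) * exp (-(c * cos θ ^ 2))) θ := by
    have h3 := ((((hasDerivAt_cos θ).pow 2).const_mul c).neg).exp
    refine ((hasDerivAt_sin θ).mul h3).congr_deriv ?_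
    simp only [Pi.pow_apply, Pi.neg_apply]
    push_cast
    ring
  rw [intervalIntegral.integral_eq_sub_of_hasDerivAt (fun θ _ => hderiv θ)
    (Continuous.intervalIntegrable (by fun_prop) _ _)]
  simp

lemma D_eq_intervalIntegral (Δ : ℝ) {l : ℝ} (hl : 0 < l) :
    D Δ l = ∫ θ in (0)..(π / 2), 2 * (√π * Δ) ^ 3 / √π *
      (√l * (cos θ ^ 3 * exp (-(l * (√π * Δ) ^ 2 * cos θ ^ 2)))) := by
  set a := √π * Δ with ha
  set S := ∫ t in Ioi (0 : ℝ), exp (-t ^ 2 / (4 * l)) * sin (a * t) with hS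
  set J := ∫ θ in (0)..(π / 2), cos θ ^ 3 * exp (-(l * a ^ 2 * cos θ ^ 2)) with hJ
  have hD : D Δ l = 1 / (2 * √(π * l ^ 3)) * (S - a * (2 * l - 2 * l * a * S)) := by
    rw [hS, ← integral_mul_exp_neg_sq_div_mul_cos hl a, ← integral_const_mul a, ← integral_sub
      (integrable_exp_neg_sq_div_mul_sin hl a).integrableOn
      ((integrable_mul_exp_neg_sq_div_mul_cos hl a).integrableOn.const_mul a),
      ← integral_const_mul, D]
    refine setIntegral_congr_fun measurableSet_Ioi fun t ht => ?_
    have ht' : t ≠ 0 := (mem_Ioi.1 ht).ne'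
    simp only [mul_comm Δ (√π), ← ha]
    field_simp
  have hone := integral_cos_mul_one_add_mul_exp (l * a ^ 2)
  have hsplit : ∫ θ in (0)..(π / 2), cos θ * (1 + 2 * (l * a ^ 2) * sin θ ^ 2) *
      exp (-(l * a ^ 2 * cos θ ^ 2)) = (1 + 2 * (l * a ^ 2)) *
      (∫ θ in (0)..(π / 2), cos θ * exp (-(l * a ^ 2 * cos θ ^ 2))) - 2 * (l * a ^ 2) * J := by
    rw [hJ, ← intervalIntegral.integral_const_mul, ← intervalIntegral.integral_const_mul,
      ← intervalIntegral.integral_sub (Continuous.intervalIntegrable (by fun_prop) _ _)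
        (Continuous.intervalIntegrable (by fun_prop) _ _)]
    refine intervalIntegral.integral_congr fun θ _ => ?_
    simp only [sin_sq]
    ring
  have hSeq : S = _ := integral_exp_neg_sq_div_mul_sin hl a
  have hroot : √(π * l ^ 3) = √π * (l * √l) := by
    rw [sqrt_mul pi_pos.le, pow_succ, sqrt_mul (by positivity), sqrt_sq hl.le]
  have hSJ : S - a * (2 * l - 2 * l * a * S) = 4 * l ^ 2 * a ^ 3 * J := by
    rw [hSeq]
    linear_combination 2 * l * a * (hone - hsplit)
  have hl2 : √l ^ 2 = l := sq_sqrt hl.le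
  rw [hD, hSJ, hroot, intervalIntegral.integral_const_mul, intervalIntegral.integral_const_mul,
    ← hJ]
  have : 0 < √l := sqrt_pos.2 hl
  have : 0 < √π := sqrt_pos.2 pi_pos
  field_simp
  rw [hl2]
  ring

lemma integral_sqrt_mul_exp_neg_mul {c : ℝ} (hc : 0 < c) :
    ∫ l in Ioi (0 : ℝ), √l * exp (-(c * l)) = √π / (2 * √c ^ 3) := by
  have h := integral_rpow_mul_exp_neg_mul_Ioi (a := 3 / 2) (by norm_num) hc
  have hG : Gamma (3 / 2) = √π / 2 := by
    rw [show (3 / 2 : ℝ) = 1 / 2 + 1 by norm_num, Gamma_add_one (by norm_num), Gamma_one_half_eq]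
    ring
  have hpow : (1 / c) ^ (3 / 2 : ℝ) = 1 / √c ^ 3 := by
    rw [show (3 / 2 : ℝ) = 1 / 2 * (3 : ℕ) by norm_num, rpow_mul (by positivity), rpow_natCast,
      ← sqrt_eq_rpow, sqrt_div zero_le_one, sqrt_one, div_pow, one_pow]
  rw [hG, hpow, show (3 / 2 - 1 : ℝ) = 1 / 2 by norm_num] at h
  simp only [← sqrt_eq_rpow] at h
  rw [h]
  ring

theorem integral_density_eq_pi_div_two (Δ : ℝ) (hΔ : 0 < Δ) :
    ∫ l in Set.Ioi (0 : ℝ), D Δ l = π / 2 := by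
  have hpi : 0 < √π := sqrt_pos.2 pi_pos
  have ha : 0 < √π * Δ := mul_pos hpi hΔ
  set a := √π * Δ with ha_def
  set f : ℝ → ℝ → ℝ := fun l θ => 2 * a ^ 3 / √π *
    (√l * (cos θ ^ 3 * exp (-(l * a ^ 2 * cos θ ^ 2)))) with hf
  have hcos {θ : ℝ} (hθ : θ ∈ Ioo 0 (π / 2)) : 0 < cos θ :=
    cos_pos_of_mem_Ioo ⟨by linarith [hθ.1, pi_pos], hθ.2⟩
  have hinner {θ : ℝ} (hθ : θ ∈ Ioo 0 (π / 2)) : ∫ l in Ioi (0 : ℝ), f l θ = 1 := by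
    have hc := hcos hθ
    have h := integral_sqrt_mul_exp_neg_mul (c := (a * cos θ) ^ 2) (by positivity)
    rw [sqrt_sq (by positivity)] at h
    have hfun (l : ℝ) : f l θ =
        2 * a ^ 3 / √π * cos θ ^ 3 * (√l * exp (-((a * cos θ) ^ 2 * l))) := by
      simp only [hf]
      rw [show l * a ^ 2 * cos θ ^ 2 = (a * cos θ) ^ 2 * l by ring]
      ring
    simp only [hfun]
    rw [integral_const_mul, h]
    field_simp
  have hnorm {θ : ℝ} (hθ : θ ∈ Ioo 0 (π / 2)) (l : ℝ) : ‖f l θ‖ = f l θ := by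
    have hc := hcos hθ
    exact Real.norm_of_nonneg (by positivity)
  have hint : Integrable (Function.uncurry f)
      ((volume.restrict (Ioi 0)).prod (volume.restrict (Ioo 0 (π / 2)))) := by
    rw [integrable_prod_iff' (by fun_prop)]
    constructor
    · refine ae_restrict_of_forall_mem measurableSet_Ioo fun θ hθ => ?_
      exact .of_integral_ne_zero (by simp [hinner hθ])
    · refine (integrable_const (1 : ℝ)).congr ?_
      refine ae_restrict_of_forall_mem measurableSet_Ioo fun θ hθ => ?_
      simp only [Function.uncurry_apply_pair, hnorm hθ, hinner hθ]
  calc ∫ l in Ioi (0 : ℝ), D Δ l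
      = ∫ l in Ioi (0 : ℝ), ∫ θ in Ioo 0 (π / 2), f l θ := by
        refine setIntegral_congr_fun measurableSet_Ioi fun l hl => ?_
        rw [D_eq_intervalIntegral Δ hl, intervalIntegral.integral_of_le (by positivity),
          integral_Ioc_eq_integral_Ioo]
    _ = ∫ θ in Ioo 0 (π / 2), ∫ l in Ioi (0 : ℝ), f l θ := integral_integral_swap hint
    _ = ∫ θ in Ioo 0 (π / 2), (1 : ℝ) :=
        setIntegral_congr_fun measurableSet_Ioo fun θ hθ => hinner hθ
    _ = π / 2 := by simp [pi_div_two_pos.le]
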